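/- Let f_i, f_j, f_k : D → R be three models whose accuracies satisfy 1 ≥ a_{f_i} > a_{f_j} > a_{f_k} ≥ 0, and let m ≥ 0 be a rational number such that any two distinct models among {f_i, f_j, f_k} agree on at most an m fraction of incorrect responses, i.e. |{d ∈ D : f(d) = f'(d) ∧ f(d) ≠ g(d)}| ≤ m·|D| for every pair of distinct models f, f' among the three. If a_{f_k} < a_{f_i} + a_{f_j} − 1 − m, then f_k is voted worse by both f_i and f_j as judges: |Agr(f_i, f_k)| < |Agr(f_i, f_j)| and |Agr(f_j, f_k)| < |Agr(f_j, f_i)|. -/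

import Mathlib

/-- The set of prompts on which model `f` answers correctly w.r.t. ground truth `g`. -/
def correctSet {D R : Type*} [Fintype D] [DecidableEq R] (g f : D → R) : Finset D :=
  Finset.univ.filter fun d => f d = g d

/-- The accuracy of model `f`: fraction of prompts answered correctly. -/
def acc {D R : Type*} [Fintype D] [DecidableEq R] (g f : D → R) : ℚ :=
  (correctSet g f).card / Fintype.card D

/-- The agreement set of two models `f`, `f'`. -/
def agr {D R : Type*} [Fintype D] [DecidableEq R] (f f' : D → R) : Finset D :=
  Finset.univ.filter fun d => f d = f' d

theorem card_agr_le {D R : Type*} [Fintype D] [DecidableEq R] (g f f' : D → R) :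
    (agr f f').card ≤ (correctSet g f').card +
      (Finset.univ.filter fun d => f d = f' d ∧ f d ≠ g d).card := by
  classical
  refine (Finset.card_le_card ?_).trans (Finset.card_union_le _ _)
  intro d hd
  simp only [agr, correctSet, Finset.mem_union, Finset.mem_filter, Finset.mem_univ,
    true_and] at hd ⊢
  grind

theorem card_correctSet_add_le {D R : Type*} [Fintype D] [DecidableEq R] (g f f' : D → R) :
    (correctSet g f).card + (correctSet g f').card ≤ Fintype.card D + (agr f f').card := by
  classical
  rw [← Finset.card_union_add_card_inter]
  refine add_le_add (Finset.card_le_univ _) (Finset.card_le_card ?_)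
  intro d hd
  simp only [agr, correctSet, Finset.mem_inter, Finset.mem_filter, Finset.mem_univ,
    true_and] at hd ⊢
  exact hd.1.trans hd.2.symm

theorem agr_comm {D R : Type*} [Fintype D] [DecidableEq R] (f f' : D → R) :
    agr f f' = agr f' f := by
  simp only [agr, eq_comm]

/-- Theorem 1: if any two distinct models among the three agree on at most an `m`
fraction of incorrect responses and `a_k < a_i + a_j − 1 − m`, then `f_k` is voted
worse by both `f_i` and `f_j` as judges. -/
theorem triplet_incorrect_agreement_at_most_m
    {D R : Type*} [Fintype D] [Nonempty D] [DecidableEq R]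
    (g f_i f_j f_k : D → R) (m : ℚ)
    (hm : 0 ≤ m)
    (h1 : 1 ≥ acc g f_i) (h2 : acc g f_i > acc g f_j) (h3 : acc g f_j > acc g f_k)
    (h4 : acc g f_k ≥ 0)
    (hagree : ∀ f f' : D → R, f ∈ ({f_i, f_j, f_k} : Set (D → R)) →
      f' ∈ ({f_i, f_j, f_k} : Set (D → R)) → f ≠ f' →
      ((Finset.univ.filter fun d => f d = f' d ∧ f d ≠ g d).card : ℚ) ≤
        m * Fintype.card D)
    (hcond : acc g f_k < acc g f_i + acc g f_j - 1 - m) :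
    (agr f_i f_k).card < (agr f_i f_j).card ∧
      (agr f_j f_k).card < (agr f_j f_i).card := by
  have hD : (0 : ℚ) < Fintype.card D := by exact_mod_cast Fintype.card_pos
  have hcard : ((correctSet g f_k).card : ℚ) + m * Fintype.card D + Fintype.card D <
      (correctSet g f_i).card + (correctSet g f_j).card := by
    have h := mul_lt_mul_of_pos_right hcond hD
    simp only [acc, sub_mul, add_mul, div_mul_cancel₀ _ hD.ne'] at h
    linarith
  have hij : ((correctSet g f_i).card : ℚ) + (correctSet g f_j).card ≤
      Fintype.card D + (agr f_i f_j).card := by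
    exact_mod_cast card_correctSet_add_le g f_i f_j
  have key : ∀ f ∈ ({f_i, f_j, f_k} : Set (D → R)), f ≠ f_k →
      (agr f f_k).card < (agr f_i f_j).card := by
    intro f hf hne
    have hfk : ((agr f f_k).card : ℚ) ≤ (correctSet g f_k).card +
        (Finset.univ.filter fun d => f d = f_k d ∧ f d ≠ g d).card := by
      exact_mod_cast card_agr_le g f f_k
    have := hagree f f_k hf (by simp) hne
    have : ((agr f f_k).card : ℚ) < (agr f_i f_j).card := by linarith
    exact_mod_cast this
  refine ⟨key f_i (by simp) ?_, agr_comm f_i f_j ▸ key f_j (by simp) ?_⟩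
  · rintro rfl
    exact lt_asymm h2 h3
  · rintro rfl
    exact lt_irrefl _ h3
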